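/- If G is a finite group such that every real element of G has prime power order, and N ⊴ G, then every real element of G/N has prime power order. -/

import Mathlib

def IsReal {G : Type*} [Group G] (x : G) : Prop := ∃ g : G, g⁻¹ * x * g = x⁻¹

theorem conj_inv_eq_of_conj_eq_inv {G : Type*} [Group G] {x g : G} (h : g⁻¹ * x * g = x⁻¹) :
    g⁻¹ * x⁻¹ * g = x := by
  calc g⁻¹ * x⁻¹ * g = (g⁻¹ * x * g)⁻¹ := by group
    _ = x := by rw [h, inv_inv]

theorem exists_subgroup_map_eq_and_map_normalizer_eq_top {G L : Type*} [Group G] [Group L]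
    [Finite G] {f : G →* L} (hf : Function.Surjective f) {p : ℕ} [Fact p.Prime] (U : Subgroup L)
    [U.Normal] (hU : IsPGroup p U) :
    ∃ P : Subgroup G, IsPGroup p P ∧ P.map f = U ∧
      (Subgroup.normalizer (P : Set G)).map f = ⊤ := by
  obtain ⟨S⟩ : Nonempty (Sylow p (U.comap f)) := Sylow.nonempty
  have hs := f.subgroupComap_surjective_of_surjective U hf
  have htop : (S.mapSurjective hs : Subgroup U) = ⊤ := by
    refine (S.mapSurjective hs).3 ?_ le_top |>.symm
    exact hU.of_equiv Subgroup.topEquiv.symm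
  have hmap : (S.map (U.comap f).subtype).map f = U := by
    have h1 : f.comp (U.comap f).subtype = U.subtype.comp (f.subgroupComap U) := rfl
    rw [Subgroup.map_map, h1, ← Subgroup.map_map, ← Sylow.coe_mapSurjective hs, htop,
      ← MonoidHom.range_eq_map, Subgroup.range_subtype]
  refine ⟨S.map (U.comap f).subtype, S.2.map _, hmap, ?_⟩
  have h := congrArg (Subgroup.map f) (Sylow.normalizer_sup_eq_top S)
  rw [Subgroup.map_sup, Subgroup.map_comap_eq_self_of_surjective hf,
    Subgroup.map_top_of_surjective f hf] at h
  rw [← h, eq_comm, sup_eq_left]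
  conv_lhs => rw [← hmap]
  exact Subgroup.map_mono Subgroup.le_normalizer

theorem ncard_modEq_ncard_inverted {G : Type*} [Group G] [Finite G] {g : G} {k : ℕ}
    (hg : g ^ 2 ^ k = 1) (A : Set G) (hA : ∀ x ∈ A, g⁻¹ * x⁻¹ * g ∈ A) :
    A.ncard ≡ {x ∈ A | g⁻¹ * x * g = x⁻¹}.ncard [MOD 2] := by
  classical
  let a : Function.End A := fun x => ⟨g⁻¹ * (x : G)⁻¹ * g, hA x x.2⟩
  have haa : ∀ n : ℕ, ∀ x : A, ((a ^ (2 * n)) x : G) = (g ^ (2 * n))⁻¹ * x * g ^ (2 * n) := by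
    intro n
    induction n with
    | zero =>
      intro x
      change (x : G) = _
      simp
    | succ n ih =>
      intro x
      have h1 : (a ^ (2 * (n + 1))) x = a (a ((a ^ (2 * n)) x)) := by
        rw [show 2 * (n + 1) = 2 * n + 1 + 1 by ring, pow_succ', pow_succ']; rfl
      have h2 : ∀ z : A, (a z : G) = g⁻¹ * (z : G)⁻¹ * g := fun z => rfl
      rw [h1, h2, h2, ih, show 2 * (n + 1) = 2 * n + 1 + 1 by ring, pow_succ, pow_succ]
      group
  have ha : a ^ 2 ^ (k + 1) = 1 := by
    funext x
    apply Subtype.ext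
    rw [pow_succ', haa, mul_comm, pow_mul, hg]
    change _ = (x : G)
    simp
  have : Fintype A := Fintype.ofFinite _
  have h := Equiv.Perm.card_fixedPoints_modEq ha
  rw [← Nat.card_eq_fintype_card, ← Nat.card_eq_fintype_card] at h
  rw [← Nat.card_coe_set_eq, ← Nat.card_coe_set_eq]
  have e : Nat.card a.fixedPoints = Nat.card {x ∈ A | g⁻¹ * x * g = x⁻¹} := by
    refine Nat.card_congr ⟨fun x => ⟨x.1.1, x.1.2, ?_⟩, fun x => ⟨⟨x.1, x.2.1⟩, ?_⟩,
      fun _ => rfl, fun _ => rfl⟩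
    · have := congrArg Subtype.val x.2
      have h3 : g⁻¹ * (x.1.1)⁻¹ * g = x.1.1 := this
      conv_rhs => rw [← h3]
      group
    · exact Subtype.ext (conj_inv_eq_of_conj_eq_inv x.2.2)
  rwa [e] at h

theorem ncard_subgroup_fiber {G L : Type*} [Group G] [Group L] (f : G →* L) (T : Subgroup G)
    {x : G} (hx : x ∈ T) :
    {z ∈ (T : Set G) | f z = f x}.ncard = Nat.card (T ⊓ f.ker : Subgroup G) := by
  rw [← Nat.card_coe_set_eq]
  refine Nat.card_congr ⟨fun z => ⟨x⁻¹ * z.1, T.mul_mem (T.inv_mem hx) z.2.1, ?_⟩,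
    fun z => ⟨x * z.1, T.mul_mem hx z.2.1, ?_⟩, fun z => ?_, fun z => ?_⟩
  · simp [z.2.2]
  · have : f z.1 = 1 := z.2.2
    simp [this]
  · simp
  · simp

theorem exists_inverted_in_fiber {G L : Type*} [Group G] [Group L] [Finite G] (f : G →* L)
    {p : ℕ} [Fact p.Prime] (hp : p ≠ 2) {T : Subgroup G} (hT : IsPGroup p T) {g : G} {k : ℕ}
    (hg : g ^ 2 ^ k = 1) (hgT : ∀ x ∈ T, g⁻¹ * x * g ∈ T) {x : G} (hx : x ∈ T)
    (hfx : (f g)⁻¹ * f x * f g = (f x)⁻¹) :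
    ∃ z ∈ T, f z = f x ∧ g⁻¹ * z * g = z⁻¹ := by
  have h := ncard_modEq_ncard_inverted hg {z ∈ (T : Set G) | f z = f x} (by
    rintro z ⟨hz, hzx⟩
    refine ⟨hgT _ (T.inv_mem hz), ?_⟩
    simp only [map_mul, map_inv, hzx]
    exact conj_inv_eq_of_conj_eq_inv hfx)
  rw [ncard_subgroup_fiber f T hx] at h
  obtain ⟨n, hn⟩ := IsPGroup.iff_card.mp (hT.to_le (inf_le_left : T ⊓ f.ker ≤ T))
  have hodd : Odd (p ^ n) := ((Fact.out : p.Prime).odd_of_ne_two hp).pow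
  rw [hn] at h
  have hne : {z ∈ {z ∈ (T : Set G) | f z = f x} | g⁻¹ * z * g = z⁻¹}.Nonempty := by
    rw [Set.nonempty_iff_ne_empty]
    intro he
    rw [he, Set.ncard_empty] at h
    have := Nat.odd_iff.mp hodd
    unfold Nat.ModEq at h
    omega
  obtain ⟨z, ⟨hz, hzx⟩, hzg⟩ := hne
  exact ⟨z, hz, hzx, hzg⟩

theorem exists_ne_one_inverted {G : Type*} [Group G] [Finite G] {T : Subgroup G}
    (hT : IsPGroup 2 T) (hT1 : T ≠ ⊥) {g : G} {k : ℕ} (hg : g ^ 2 ^ k = 1)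
    (hgT : ∀ x ∈ T, g⁻¹ * x * g ∈ T) : ∃ z ∈ T, z ≠ 1 ∧ g⁻¹ * z * g = z⁻¹ := by
  have h := ncard_modEq_ncard_inverted hg (T : Set G) fun x hx => hgT _ (T.inv_mem hx)
  have : Nontrivial T := T.nontrivial_iff_ne_bot.mpr hT1
  obtain ⟨n, hn0, hn⟩ := hT.nontrivial_iff_card.mp this
  have hc : (T : Set G).ncard = 2 ^ n := hn
  rw [hc] at h
  by_contra! hcon
  have he : {x ∈ (T : Set G) | g⁻¹ * x * g = x⁻¹} = {1} := by
    ext x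
    constructor
    · rintro ⟨hx, hxg⟩
      by_contra hx1
      exact hcon x hx hx1 hxg
    · rintro rfl
      exact ⟨T.one_mem, by simp⟩
  rw [he, Set.ncard_singleton] at h
  have : 2 ∣ 2 ^ n := dvd_pow_self 2 hn0.ne'
  unfold Nat.ModEq at h
  omega

theorem exists_centralizing_in_fiber {G L : Type*} [Group G] [Group L] [Finite G] (f : G →* L)
    {p q : ℕ} [Fact p.Prime] [Fact q.Prime] (hpq : p ≠ q) {P Q : Subgroup G} [P.Normal]
    (hP : IsPGroup p P) (hQ : IsPGroup q Q) {x : G} (hx : x ∈ P)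
    (hc : ∀ z ∈ Q, Commute (f z) (f x)) :
    ∃ z ∈ P ⊓ Subgroup.centralizer (Q : Set G), f z = f x := by
  let A : Set G := {z ∈ (P : Set G) | f z = f x}
  let _ : MulAction Q A :=
    { smul := fun s z => ⟨s * z.1 * (s : G)⁻¹, ‹P.Normal›.conj_mem _ z.2.1 _, by
        rw [map_mul, map_mul, z.2.2, (hc s s.2).eq, map_inv, mul_inv_cancel_right]⟩
      one_smul := fun z => Subtype.ext (by
        change ((1 : Q) : G) * z.1 * ((1 : Q) : G)⁻¹ = z.1
        simp)
      mul_smul := fun s t z => Subtype.ext (by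
        change ((s * t : Q) : G) * z.1 * ((s * t : Q) : G)⁻¹ = s * (t * z.1 * (t : G)⁻¹) * (s : G)⁻¹
        push_cast
        group) }
  have hcard : ¬ q ∣ Nat.card A := by
    obtain ⟨n, hn⟩ := IsPGroup.iff_card.mp (hP.to_le (inf_le_left : P ⊓ f.ker ≤ P))
    have hA : Nat.card A = p ^ n := by
      rw [← hn, ← ncard_subgroup_fiber f P hx, Nat.card_coe_set_eq]
    rw [hA]
    intro hd
    exact hpq ((Nat.prime_dvd_prime_iff_eq Fact.out Fact.out).mp
      ((Fact.out : q.Prime).dvd_of_dvd_pow hd)).symm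
  obtain ⟨z, hz⟩ := hQ.nonempty_fixed_point_of_prime_not_dvd_card A hcard
  refine ⟨z.1, ⟨z.2.1, ?_⟩, z.2.2⟩
  change z.1 ∈ Subgroup.centralizer (Q : Set G)
  rw [Subgroup.mem_centralizer_iff]
  intro s hs
  have h : s * z.1 * s⁻¹ = z.1 := congrArg Subtype.val (hz ⟨s, hs⟩)
  exact mul_inv_eq_iff_eq_mul.mp h

theorem inverted_pow_of_odd {L : Type*} [Group L] {u g : L} (h : g⁻¹ * u * g = u⁻¹) {m : ℕ}
    (hm : Odd m) : (g ^ m)⁻¹ * u * g ^ m = u⁻¹ := by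
  obtain ⟨n, rfl⟩ := hm
  induction n with
  | zero => simpa using h
  | succ n ih =>
    rw [show 2 * (n + 1) + 1 = 2 * n + 1 + 1 + 1 by ring, pow_succ, pow_succ]
    calc (g ^ (2 * n + 1) * g * g)⁻¹ * u * (g ^ (2 * n + 1) * g * g)
        = g⁻¹ * (g⁻¹ * ((g ^ (2 * n + 1))⁻¹ * u * g ^ (2 * n + 1)) * g) * g := by group
      _ = u⁻¹ := by rw [ih, conj_inv_eq_of_conj_eq_inv h, h]

theorem IsPGroup.dvd_orderOf_of_mem {G : Type*} [Group G] {p : ℕ} [Fact p.Prime] {T : Subgroup G}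
    (hT : IsPGroup p T) {x : G} (hx : x ∈ T) (hx1 : x ≠ 1) :
    p ∣ orderOf x ∧ ∃ n, orderOf x = p ^ n := by
  obtain ⟨n, hn⟩ := IsPGroup.iff_orderOf.mp hT ⟨x, hx⟩
  rw [Subgroup.orderOf_mk] at hn
  refine ⟨?_, n, hn⟩
  rw [hn]
  refine dvd_pow_self p ?_
  rintro rfl
  exact hx1 (orderOf_eq_one_iff.mp (by simpa using hn))

theorem exists_real_of_normal_subgroup {G L : Type*} [Group G] [Group L] [Finite G] {f : G →* L}
    (hf : Function.Surjective f) {p q : ℕ} [Fact p.Prime] [Fact q.Prime] (hpq : p ≠ q)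
    (hp : p ≠ 2) {P : Subgroup G} [P.Normal] (hP : IsPGroup p P) {u w g : L}
    (hu : u ∈ P.map f) (hu1 : u ≠ 1) (hw1 : w ≠ 1) (hw : IsPGroup q (Subgroup.zpowers w))
    [(Subgroup.zpowers w).Normal] (huw : Commute u w) (hgu : g⁻¹ * u * g = u⁻¹)
    (hgw : g⁻¹ * w * g = w⁻¹) : ∃ x : G, IsReal x ∧ p ∣ orderOf x ∧ q ∣ orderOf x := by
  obtain ⟨Q, hQ, hQw, hQN⟩ :=
    exists_subgroup_map_eq_and_map_normalizer_eq_top hf (Subgroup.zpowers w) hw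
  obtain ⟨b, hbQ, hb⟩ : g ∈ (Subgroup.normalizer (Q : Set G)).map f := hQN ▸ Subgroup.mem_top g
  obtain ⟨k, m, hm, hkm⟩ := Nat.exists_eq_two_pow_mul_odd (orderOf_pos b).ne'
  have hc2 : (b ^ m) ^ 2 ^ k = 1 := by rw [← pow_mul, mul_comm, ← hkm, pow_orderOf_eq_one]
  have hcu := inverted_pow_of_odd hgu hm
  have hcw := inverted_pow_of_odd hgw hm
  have hcQ := Subgroup.pow_mem _ hbQ m
  rw [← hb, ← map_pow] at hcu hcw
  generalize b ^ m = c at hc2 hcu hcw hcQ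
  have hcQ' : ∀ x ∈ Q, c⁻¹ * x * c ∈ Q := fun x => (Subgroup.mem_normalizer_iff''.mp hcQ x).mp
  have hcQ'' : ∀ x ∈ Q, c * x * c⁻¹ ∈ Q := fun x => (Subgroup.mem_normalizer_iff.mp hcQ x).mp
  obtain ⟨x₀, hx₀, rfl⟩ := hu
  obtain ⟨x₁, hx₁, hx₁₀⟩ := exists_centralizing_in_fiber f hpq hP hQ hx₀ (by
    intro z hz
    obtain ⟨i, hi⟩ : f z ∈ Subgroup.zpowers w := hQw ▸ Subgroup.mem_map_of_mem f hz
    rw [← hi]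
    exact (huw.zpow_right i).symm)
  obtain ⟨x, hx, hxu, hxc⟩ := exists_inverted_in_fiber f hp (hP.to_le inf_le_left) hc2 (by
    rintro z ⟨hzP, hzQ⟩
    refine ⟨?_, ?_⟩
    · simpa using ‹P.Normal›.conj_mem z hzP c⁻¹
    · change c⁻¹ * z * c ∈ Subgroup.centralizer (Q : Set G)
      rw [Subgroup.mem_centralizer_iff]
      intro s hs
      have := Subgroup.mem_centralizer_iff.mp hzQ _ (hcQ'' s hs)
      calc s * (c⁻¹ * z * c) = c⁻¹ * ((c * s * c⁻¹) * z) * c := by group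
        _ = c⁻¹ * z * c * s := by rw [this]; group) hx₁ (by rwa [hx₁₀])
  obtain ⟨z, hz, hz1, hzc⟩ : ∃ z ∈ Q, z ≠ 1 ∧ c⁻¹ * z * c = z⁻¹ := by
    obtain ⟨z₀, hz₀, hz₀w⟩ : w ∈ Q.map f := hQw ▸ Subgroup.mem_zpowers w
    by_cases hq : q = 2
    · subst hq
      refine exists_ne_one_inverted hQ ?_ hc2 hcQ'
      rintro rfl
      rw [Subgroup.mem_bot.mp hz₀, map_one] at hz₀w
      exact hw1 hz₀w.symm
    · obtain ⟨z, hz, hzw, hzc⟩ := exists_inverted_in_fiber f hq hQ hc2 hcQ' hz₀ (by rwa [hz₀w])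
      refine ⟨z, hz, ?_, hzc⟩
      rintro rfl
      rw [hz₀w, map_one] at hzw
      exact hw1 hzw.symm
  have hx1 : x ≠ 1 := by
    rintro rfl
    rw [map_one, hx₁₀] at hxu
    exact hu1 hxu.symm
  have hcomm : Commute x z := ((Subgroup.mem_centralizer_iff.mp hx.2) z hz).symm
  obtain ⟨hpx, n, hn⟩ := hP.dvd_orderOf_of_mem hx.1 hx1
  obtain ⟨hqz, l, hl⟩ := hQ.dvd_orderOf_of_mem hz hz1
  have hord : orderOf (x * z) = orderOf x * orderOf z := by
    refine hcomm.orderOf_mul_eq_mul_orderOf_of_coprime ?_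
    rw [hn, hl]
    exact Nat.Coprime.pow _ _ ((Nat.coprime_primes Fact.out Fact.out).mpr hpq)
  refine ⟨x * z, ⟨c, ?_⟩, hord ▸ hpx.mul_right _, hord ▸ hqz.mul_left _⟩
  calc c⁻¹ * (x * z) * c = (c⁻¹ * x * c) * (c⁻¹ * z * c) := by group
    _ = (x * z)⁻¹ := by rw [hxc, hzc, hcomm.eq, mul_inv_rev]

theorem IsReal.map {G H : Type*} [Group G] [Group H] (f : G →* H) {x : G} (hx : IsReal x) :
    IsReal (f x) := by
  obtain ⟨g, hg⟩ := hx
  exact ⟨f g, by rw [← map_inv, ← map_mul, ← map_mul, hg, map_inv]⟩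

theorem exists_real_of_surjective {G L : Type*} [Group G] [Group L] [Finite G] {f : G →* L}
    (hf : Function.Surjective f) {p q : ℕ} [Fact p.Prime] [Fact q.Prime] (hpq : p ≠ q)
    (hp : p ≠ 2) {u w g : L} (hu1 : u ≠ 1) (hw1 : w ≠ 1)
    (hu : IsPGroup p (Subgroup.zpowers u)) (hw : IsPGroup q (Subgroup.zpowers w))
    [(Subgroup.zpowers u).Normal] [(Subgroup.zpowers w).Normal] (huw : Commute u w)
    (hgu : g⁻¹ * u * g = u⁻¹) (hgw : g⁻¹ * w * g = w⁻¹) :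
    ∃ x : G, IsReal x ∧ p ∣ orderOf x ∧ q ∣ orderOf x := by
  obtain ⟨P, hP, hPu, hPN⟩ :=
    exists_subgroup_map_eq_and_map_normalizer_eq_top hf (Subgroup.zpowers u) hu
  have hf' : Function.Surjective (f.comp (Subgroup.normalizer (P : Set G)).subtype) := by
    intro l
    obtain ⟨a, ha, rfl⟩ : l ∈ (Subgroup.normalizer (P : Set G)).map f := hPN ▸ Subgroup.mem_top l
    exact ⟨⟨a, ha⟩, rfl⟩
  have hP' : IsPGroup p (P.subgroupOf (Subgroup.normalizer (P : Set G))) :=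
    hP.of_equiv (Subgroup.subgroupOfEquivOfLe Subgroup.le_normalizer).symm
  obtain ⟨x, hx, hxp, hxq⟩ := exists_real_of_normal_subgroup hf' hpq hp hP' (u := u) (by
    rw [← Subgroup.map_map, Subgroup.subgroupOf_map_subtype,
      inf_of_le_left Subgroup.le_normalizer, hPu]
    exact Subgroup.mem_zpowers u) hu1 hw1 hw huw hgu hgw
  exact ⟨x, hx.map (Subgroup.subtype _), by rwa [Subgroup.orderOf_coe],
    by rwa [Subgroup.orderOf_coe]⟩

theorem Subgroup.normal_zpowers_pow {L : Type*} [Group L] {y : L} [(zpowers y).Normal] (n : ℕ) :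
    (zpowers (y ^ n)).Normal := by
  constructor
  rintro _ ⟨i, rfl⟩ l
  obtain ⟨j, hj⟩ : l * y * l⁻¹ ∈ zpowers y := ‹(zpowers y).Normal›.conj_mem y (mem_zpowers y) l
  refine ⟨j * i, ?_⟩
  dsimp only at hj ⊢
  rw [← conj_zpow, ← conj_pow, ← hj, ← zpow_natCast y n, ← zpow_natCast (y ^ j) n, ← zpow_mul,
    ← zpow_mul, ← zpow_mul]
  congr 1
  ring

theorem inverted_pow {L : Type*} [Group L] {y g : L} (h : g⁻¹ * y * g = y⁻¹) (n : ℕ) :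
    g⁻¹ * y ^ n * g = (y ^ n)⁻¹ := by
  have := conj_pow (a := g⁻¹) (b := y) (i := n)
  rw [inv_inv] at this
  rw [← this, h, inv_pow]

theorem exists_pow_isPGroup {L : Type*} [Group L] [Finite L] {y : L} {p : ℕ} [Fact p.Prime]
    (hp : p ∣ orderOf y) : ∃ n : ℕ, y ^ n ≠ 1 ∧ IsPGroup p (Subgroup.zpowers (y ^ n)) := by
  have h := orderOf_pow_orderOf_div (orderOf_pos y).ne' hp
  refine ⟨orderOf y / p, ?_, IsPGroup.of_card (n := 1) (by rw [Nat.card_zpowers, h, pow_one])⟩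
  intro h1
  rw [h1, orderOf_one] at h
  exact (Fact.out : p.Prime).one_lt.ne h

theorem exists_real_dvd_orderOf {G L : Type*} [Group G] [Group L] [Finite G] {f : G →* L}
    (hf : Function.Surjective f) {p q : ℕ} [Fact p.Prime] [Fact q.Prime] (hpq : p ≠ q)
    (hp : p ≠ 2) {y : L} (hy : IsReal y) (hpy : p ∣ orderOf y) (hqy : q ∣ orderOf y) :
    ∃ x : G, IsReal x ∧ p ∣ orderOf x ∧ q ∣ orderOf x := by
  have : Finite L := Finite.of_surjective f hf
  obtain ⟨g, hg⟩ := hy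
  let M : Subgroup L := Subgroup.normalizer (Subgroup.zpowers y : Set L)
  have hyM : y ∈ M := Subgroup.le_normalizer (Subgroup.mem_zpowers y)
  have hgM : g ∈ M := by
    rw [Subgroup.mem_normalizer_iff_map_conj_eq, MonoidHom.map_zpowers]
    have h : g * y * g⁻¹ = y⁻¹ := by
      conv_lhs => rw [← conj_inv_eq_of_conj_eq_inv hg]
      group
    change Subgroup.zpowers (g * y * g⁻¹) = _
    rw [h, Subgroup.zpowers_inv]
  let y' : M := ⟨y, hyM⟩
  let g' : M := ⟨g, hgM⟩
  have hg' : g'⁻¹ * y' * g' = y'⁻¹ := Subtype.ext hg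
  have hN : (Subgroup.zpowers y').Normal := by
    have h : Subgroup.zpowers y' = (Subgroup.zpowers y).subgroupOf M := by
      ext z
      rw [Subgroup.mem_subgroupOf, Subgroup.mem_zpowers_iff, Subgroup.mem_zpowers_iff]
      exact exists_congr fun k => Subtype.ext_iff
    rw [h]
    exact Subgroup.normal_in_normalizer
  have hord : orderOf y' = orderOf y := Subgroup.orderOf_mk y hyM
  rw [← hord] at hpy hqy
  obtain ⟨m, hm1, hm⟩ := exists_pow_isPGroup hpy
  obtain ⟨n, hn1, hn⟩ := exists_pow_isPGroup hqy
  have := Subgroup.normal_zpowers_pow (y := y') m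
  have := Subgroup.normal_zpowers_pow (y := y') n
  obtain ⟨x, hx, hxp, hxq⟩ := exists_real_of_surjective
    (f.subgroupComap_surjective_of_surjective M hf) hpq hp hm1 hn1 hm hn
    ((Commute.refl y').pow_pow m n) (inverted_pow hg' m) (inverted_pow hg' n)
  exact ⟨x, hx.map (Subgroup.subtype _), by rwa [Subgroup.orderOf_coe],
    by rwa [Subgroup.orderOf_coe]⟩

theorem stmt_5 {G : Type*} [Group G] [Finite G] (N : Subgroup G) [N.Normal]
    (hG : ∀ x : G, IsReal x → x = 1 ∨ IsPrimePow (orderOf x)) :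
    ∀ y : G ⧸ N, IsReal y → y = 1 ∨ IsPrimePow (orderOf y) := by
  intro y hy
  by_contra! ⟨hy1, hyp⟩
  have key : ∀ p q : ℕ, p.Prime → q.Prime → p ≠ q → p ≠ 2 → p ∣ orderOf y → q ∣ orderOf y →
      False := by
    intro p q hp hq hpq hp2 hpy hqy
    have := Fact.mk hp
    have := Fact.mk hq
    obtain ⟨x, hx, hxp, hxq⟩ :=
      exists_real_dvd_orderOf (QuotientGroup.mk'_surjective N) hpq hp2 hy hpy hqy
    rcases hG x hx with rfl | h
    · rw [orderOf_one] at hxp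
      exact hp.not_dvd_one hxp
    · exact hpq ((isPrimePow_iff_unique_prime_dvd.mp h).unique ⟨hp, hxp⟩ ⟨hq, hxq⟩)
  obtain ⟨p, hp, hpy⟩ := Nat.exists_prime_and_dvd (mt orderOf_eq_one_iff.mp hy1)
  refine hyp (isPrimePow_iff_unique_prime_dvd.mpr ⟨p, ⟨hp, hpy⟩, ?_⟩)
  rintro q ⟨hq, hqy⟩
  by_contra hqp
  by_cases hp2 : p = 2
  · exact key q p hq hp hqp (fun h => hqp (h.trans hp2.symm)) hqy hpy
  · exact key p q hp hq (Ne.symm hqp) hp2 hpy hqy
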